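/- arXiv:2111.06848 — 4 statements merged into one kernel-verified Lean document; each statement's English description precedes it below -/
import Mathlib

section
/- Let A be a commutative Noetherian ring and B a finite flat A-algebra. Let M be a finite B-module that is projective as an A-module. If Hom_B(M,B) is projective as a B-module, then M is projective as a B-module. -/
open scoped TensorProduct

/-- Flatness computes colon ideals: if `(xA : a) ⊆ p` then `(xB : a) ⊆ pB`. -/
lemma Module.Flat.mem_map_of_mul_eq_smul {A B : Type*} [CommRing A] [CommRing B] [Algebra A B]
    [Module.Flat A B] {p : Ideal A} {a x : A} (hp : ∀ r s, r * a = x * s → r ∈ p) {b c : B}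
    (h : b * algebraMap A B a = x • c) : b ∈ p.map (algebraMap A B) := by
  have h' : ∑ i, (![a, -x] : Fin 2 → A) i • (![b, c] : Fin 2 → B) i = 0 := by
    rw [Fin.sum_univ_two]
    simp only [Matrix.cons_val_zero, Matrix.cons_val_one, Algebra.smul_def, map_neg] at h ⊢
    linear_combination h
  obtain ⟨k, r, y, hy, hr⟩ := Module.Flat.isTrivialRelation_of_sum_smul_eq_zero (R := A) (M := B) h'
  have hb : b = ∑ j, r 0 j • y j := hy 0
  rw [hb]
  refine Ideal.sum_mem _ fun j _ => ?_
  rw [Algebra.smul_def]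
  refine Ideal.mul_mem_right _ _ (Ideal.mem_map_of_mem _ (hp _ (r 1 j) ?_))
  have := hr j
  simp only [Fin.sum_univ_two, Matrix.cons_val_zero, Matrix.cons_val_one] at this
  linear_combination this

/-- Over a flat algebra, an element killing `Ann_A x` also kills `Ann_B x`. -/
lemma Module.Flat.smul_eq_zero_of_smul_eq_zero {A B : Type*} [CommRing A] [CommRing B]
    [Algebra A B] [Module.Flat A B] {u x : A} (hu : ∀ r, x * r = 0 → u * r = 0) {b : B}
    (h : x • b = 0) : u • b = 0 := by
  have hb : b ∈ Ideal.map (algebraMap A B) (LinearMap.ker (LinearMap.mulLeft A u)) :=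
    Module.Flat.mem_map_of_mul_eq_smul (a := x) (x := 0) (c := (0 : B))
      (fun r s hrs => hu r (by linear_combination hrs))
      (by simpa [Algebra.smul_def, mul_comm] using h)
  have hle : Ideal.map (algebraMap A B) (LinearMap.ker (LinearMap.mulLeft A u)) ≤
      LinearMap.ker (LinearMap.mulLeft B (algebraMap A B u)) := by
    refine Ideal.map_le_iff_le_comap.2 fun r hr => ?_
    simpa [← map_mul] using congrArg (algebraMap A B) hr
  simpa [Algebra.smul_def] using hle hb

/-- Associated primes of `B / xB` from associated primes of `A / xA`, along a finite flat
extension. -/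
lemma exists_colon_eq_of_flat {A B : Type*} [CommRing A] [CommRing B] [IsNoetherianRing B]
    [Algebra A B] [Module.Finite A B] [Module.Flat A B] (q : Ideal B) [hq : q.IsPrime] {a x : A}
    (ha : ∀ r, (∃ s, r * a = x * s) ↔ algebraMap A B r ∈ q) :
    ∃ s : B, ∀ b, (∃ c, b * s = x • c) ↔ b ∈ q := by
  let I : Ideal B := Ideal.span {algebraMap A B x}
  have hI (b : B) : b ∈ I ↔ ∃ c, b = x • c := by
    simp [I, Ideal.mem_span_singleton, dvd_def, Algebra.smul_def]
  let N : Submodule B (B ⧸ I) := Submodule.span B {Submodule.Quotient.mk (algebraMap A B a)}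
  have hmk (b : B) (s : B) : b • (Submodule.Quotient.mk s : B ⧸ I) = 0 ↔ ∃ c, b * s = x • c := by
    rw [← Submodule.Quotient.mk_smul, Submodule.Quotient.mk_eq_zero, hI, smul_eq_mul]
  have hN : Module.annihilator B N = (q.comap (algebraMap A B)).map (algebraMap A B) := by
    ext b
    rw [Submodule.mem_annihilator_span_singleton, hmk]
    refine ⟨fun ⟨c, hc⟩ => Module.Flat.mem_map_of_mul_eq_smul (a := a) (x := x)
      (fun r s hrs => (ha r).1 ⟨s, hrs⟩) hc, fun hb => ?_⟩
    rw [← hmk, ← Submodule.mem_annihilator_span_singleton]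
    revert b
    refine Ideal.map_le_iff_le_comap.2 fun r hr => ?_
    obtain ⟨s, hs⟩ := (ha r).2 hr
    rw [Ideal.mem_comap, Submodule.mem_annihilator_span_singleton, hmk]
    exact ⟨algebraMap A B s, by rw [← map_mul, hs, map_mul, Algebra.smul_def]⟩
  have hmin : q ∈ (Module.annihilator B N).minimalPrimes := by
    rw [hN]
    refine ⟨⟨hq, Ideal.map_comap_le⟩, fun q' ⟨hq', hle⟩ hq'q => ?_⟩
    by_contra hne
    have := hq'
    exact not_le_of_gt (Ideal.IsIntegral.comap_lt_comap (R := A) (lt_of_le_not_ge hq'q hne))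
      (Ideal.map_le_iff_le_comap.1 hle)
  have hass := Module.associatedPrimes.minimalPrimes_annihilator_subset_associatedPrimes B N hmin
  rw [AssociatedPrimes.mem_iff, isAssociatedPrime_iff] at hass
  obtain ⟨-, ⟨n, hn⟩, hqn⟩ := hass
  obtain ⟨s, rfl⟩ := Submodule.Quotient.mk_surjective _ n
  refine ⟨s, fun b => ?_⟩
  rw [hqn, ← hmk, Submodule.mem_colon_singleton]
  simp [← SetLike.coe_eq_coe]

/-- A prime in the support of a finite module `C` admits a nonzero map `C → B / q`. -/
lemma exists_linearMap_quotient_ne_zero {B C : Type*} [CommRing B] [AddCommGroup C] [Module B C]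
    [IsNoetherianRing B] [Module.Finite B C] (q : PrimeSpectrum B) (hq : q ∈ Module.support B C) :
    ∃ θ : C →ₗ[B] B ⧸ q.asIdeal, θ ≠ 0 := by
  let κ := q.asIdeal.ResidueField
  have : Nontrivial (TensorProduct B κ C) :=
    (Module.mem_support_iff_nontrivial_residueField_tensorProduct q).1 hq
  obtain ⟨φ, hφ⟩ : ∃ φ : Module.Dual κ (TensorProduct B κ C), φ ≠ 0 := exists_ne 0
  let g : C →ₗ[B] κ := φ.restrictScalars B ∘ₗ TensorProduct.mk B κ C 1
  have hg : g ≠ 0 := by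
    intro h0
    refine hφ (TensorProduct.AlgebraTensorModule.ext fun a c => ?_)
    have hc : φ (1 ⊗ₜ c) = 0 := LinearMap.congr_fun h0 c
    have ha : a ⊗ₜ[B] c = a • ((1 : κ) ⊗ₜ[B] c) := by simp [TensorProduct.smul_tmul']
    rw [ha, map_smul, hc, smul_zero, LinearMap.zero_apply]
  let j : B ⧸ q.asIdeal →ₗ[B] κ := (IsScalarTower.toAlgHom B (B ⧸ q.asIdeal) κ).toLinearMap
  have hS : Algebra.algebraMapSubmonoid (B ⧸ q.asIdeal) q.asIdeal.primeCompl =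
      nonZeroDivisors (B ⧸ q.asIdeal) := by
    ext b
    obtain ⟨b, rfl⟩ := Ideal.Quotient.mk_surjective b
    rw [mem_nonZeroDivisors_iff_ne_zero, Ne, Ideal.Quotient.eq_zero_iff_mem]
    refine ⟨fun ⟨b', hb', h⟩ hb => hb' ?_, fun hb => ⟨b, hb, rfl⟩⟩
    rw [← Ideal.Quotient.eq_zero_iff_mem] at hb
    exact Ideal.Quotient.eq_zero_iff_mem.1 (h.trans hb)
  have : IsLocalizedModule q.asIdeal.primeCompl j := by
    rw [isLocalizedModule_iff_isLocalization, hS]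
    infer_instance
  have := Module.finitePresentation_of_finite B C
  obtain ⟨θ, t, hθ⟩ :=
    Module.FinitePresentation.exists_lift_of_isLocalizedModule q.asIdeal.primeCompl j g
  refine ⟨θ, fun h0 => hg (LinearMap.ext fun c => ?_)⟩
  have hc : (t : B) • g c = 0 := by simpa [h0] using! (LinearMap.congr_fun hθ c).symm
  rw [← algebraMap_smul κ, smul_eq_zero, Ideal.algebraMap_residueField_eq_zero] at hc
  exact hc.resolve_left t.2

section Dual

variable {B M : Type*} [CommRing B] [AddCommGroup M] [Module B M]

open Module

/-- If `q` is an associated prime of `B / xB`, where `x` is zero or regular at `q`, then the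
evaluation map of a module with projective dual is surjective at `q`. -/
lemma notMem_support_quotient_range_eval [IsNoetherianRing B] [Module.Finite B (Dual B M)]
    [Projective B (Dual B M)] (q : PrimeSpectrum B) {s x : B}
    (hs : ∀ b, (∃ c, b * s = x * c) ↔ b ∈ q.asIdeal)
    (hx : x = 0 ∨ ∃ u ∉ q.asIdeal, ∀ b, x * b = 0 → u * b = 0) :
    q ∉ support B (Dual B (Dual B M) ⧸ LinearMap.range (Dual.eval B M)) := by
  have key (f : Dual B M) (hf : ∀ m, f m ∈ q.asIdeal) (l : Dual B (Dual B M)) :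
      l f ∈ q.asIdeal := by
    obtain ⟨u, hu, g, hg⟩ : ∃ u ∉ q.asIdeal, ∃ g : Dual B M, (u * s) • f = x • g := by
      choose c hc using fun m => (hs (f m)).2 (hf m)
      obtain rfl | ⟨u, hu, hxu⟩ := hx
      · refine ⟨1, (Ideal.ne_top_iff_one _).1 q.2.ne_top, 0, LinearMap.ext fun m => ?_⟩
        simpa [mul_comm] using hc m
      · refine ⟨u, hu, { toFun := fun m => u * c m, map_add' := fun m n => ?_,
                         map_smul' := fun b m => ?_ }, LinearMap.ext fun m => ?_⟩
        · have := hxu (c (m + n) - (c m + c n)) (by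
            have h := hc (m + n)
            rw [map_add] at h
            linear_combination hc m + hc n - h)
          linear_combination this
        · have := hxu (c (b • m) - b * c m) (by
            have h := hc (b • m)
            rw [map_smul, smul_eq_mul] at h
            linear_combination b * hc m - h)
          simp only [smul_eq_mul, RingHom.id_apply]
          linear_combination this
        · simp only [LinearMap.smul_apply, LinearMap.coe_mk, AddHom.coe_mk, smul_eq_mul]
          linear_combination u * hc m
    have hl := congrArg l hg
    rw [map_smul, map_smul, smul_eq_mul, smul_eq_mul] at hl
    exact (q.2.mem_or_mem ((hs (u * l f)).1 ⟨l g, by linear_combination hl⟩)).resolve_left hu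
  intro hq
  obtain ⟨θ, hθ⟩ := exists_linearMap_quotient_ne_zero q hq
  obtain ⟨F, hF⟩ := projective_lifting_property q.asIdeal.mkQ
    (θ ∘ₗ (LinearMap.range (Dual.eval B M)).mkQ) (Submodule.mkQ_surjective _)
  obtain ⟨f, rfl⟩ := (bijective_dual_eval B (Dual B M)).2 F
  have hF' (l : Dual B (Dual B M)) :
      Submodule.Quotient.mk (l f) = θ (Submodule.Quotient.mk l) := LinearMap.congr_fun hF l
  have hf (m : M) : f m ∈ q.asIdeal := by
    have h0 : (Submodule.Quotient.mk (Dual.eval B M m) :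
        Dual B (Dual B M) ⧸ LinearMap.range (Dual.eval B M)) = 0 :=
      (Submodule.Quotient.mk_eq_zero _).2 ⟨m, rfl⟩
    have := hF' (Dual.eval B M m)
    rwa [h0, map_zero, Submodule.Quotient.mk_eq_zero] at this
  refine hθ (LinearMap.ext fun c => ?_)
  obtain ⟨l, rfl⟩ := Submodule.Quotient.mk_surjective _ c
  rw [← hF', LinearMap.zero_apply, Submodule.Quotient.mk_eq_zero]
  exact key f hf l

/-- If `q` is an associated prime of `B` and the evaluation map of a finite module with projective
dual is surjective at `q`, then it is injective at `q`. -/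
lemma notMem_support_ker_eval [IsNoetherianRing B] [Module.Finite B M]
    [Module.Finite B (Dual B M)] [Projective B (Dual B M)] (q : PrimeSpectrum B) {s : B}
    (hs : ∀ b, b * s = 0 ↔ b ∈ q.asIdeal)
    (hq : q ∉ support B (Dual B (Dual B M) ⧸ LinearMap.range (Dual.eval B M))) :
    q ∉ support B (LinearMap.ker (Dual.eval B M)) := by
  intro hK
  obtain ⟨θ, hθ⟩ := exists_linearMap_quotient_ne_zero q hK
  rw [mem_support_iff_of_finite, SetLike.not_le_iff_exists] at hq
  obtain ⟨t, ht, htq⟩ := hq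
  have hrange (l : Dual B (Dual B M)) : t • l ∈ LinearMap.range (Dual.eval B M) := by
    rw [← Submodule.Quotient.mk_eq_zero, Submodule.Quotient.mk_smul]
    exact mem_annihilator.1 ht _
  obtain ⟨σ, hσ⟩ := projective_lifting_property (Dual.eval B M).rangeRestrict
    ((LinearMap.lsmul B _ t).codRestrict _ hrange) (LinearMap.surjective_rangeRestrict _)
  have hσ' (l : Dual B (Dual B M)) : Dual.eval B M (σ l) = t • l :=
    congrArg Subtype.val (LinearMap.congr_fun hσ l)
  let π : M →ₗ[B] LinearMap.ker (Dual.eval B M) :=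
    (LinearMap.lsmul B M t - σ ∘ₗ Dual.eval B M).codRestrict _ fun m => by
      rw [LinearMap.mem_ker, LinearMap.sub_apply, map_sub, LinearMap.comp_apply, hσ',
        LinearMap.lsmul_apply, map_smul, sub_self]
  let ι : B ⧸ q.asIdeal →ₗ[B] B := q.asIdeal.liftQ (LinearMap.toSpanSingleton B B s)
    fun b hb => (hs b).2 hb
  refine hθ (LinearMap.ext fun k => ?_)
  have hπ : π k = t • k := by
    ext
    have : Dual.eval B M k = 0 := k.2
    simp [π, this]
  have h0 : ι (θ (π k)) = 0 := LinearMap.congr_fun (LinearMap.mem_ker.1 k.2) (ι ∘ₗ θ ∘ₗ π)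
  obtain ⟨b, hb⟩ := Submodule.Quotient.mk_surjective _ (θ k)
  rw [hπ, map_smul, ← hb, ← Submodule.Quotient.mk_smul] at h0
  have := (q.2.mem_or_mem ((hs (t * b)).1 h0)).resolve_left htq
  rw [← hb, LinearMap.zero_apply, Submodule.Quotient.mk_eq_zero]
  exact this

end Dual

/-- An associated prime of `M / xM` is an associated prime of `A / xA` when `M` is finite
projective. -/
lemma Module.Projective.exists_colon_eq {A M : Type*} [CommRing A] [AddCommGroup M] [Module A M]
    [Module.Finite A M] [Module.Projective A M] {p : Ideal A} (hp : p.IsPrime) {x : A} {z : M}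
    (hz : ∀ r : A, (∃ m, r • z = x • m) ↔ r ∈ p) :
    ∃ a, ∀ r, (∃ s, r * a = x * s) ↔ r ∈ p := by
  obtain ⟨n, f, g, -, -, hfg⟩ := Module.Finite.exists_comp_eq_id_of_projective A M
  let J (i : Fin n) : Ideal A := (Ideal.span {x}).colon {g z i}
  have hJ (i : Fin n) (r : A) : r ∈ J i ↔ ∃ s, r * g z i = x * s := by
    simp [J, Submodule.mem_colon_singleton, Ideal.mem_span_singleton, dvd_def]
  have hle : Finset.univ.inf J ≤ p := by
    intro r hr
    choose s hs using fun i => (hJ i r).1 ((Finset.inf_le (f := J) (Finset.mem_univ i)) hr)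
    refine (hz r).1 ⟨f s, ?_⟩
    have : r • g z = x • s := funext hs
    rw [← map_smul, ← this, map_smul]
    exact congrArg (r • ·) (LinearMap.congr_fun hfg z).symm
  obtain ⟨i, -, hi⟩ := (Ideal.IsPrime.inf_le' hp).1 hle
  refine ⟨g z i, fun r => ⟨fun h => hi ((hJ i r).2 h), fun hr => ?_⟩⟩
  obtain ⟨m, hm⟩ := (hz r).2 hr
  exact ⟨g m i, by simpa using congrFun (congrArg g hm) i⟩

/-- A prime of a Noetherian ring is associated, or contains an element regular at it. -/
lemma Ideal.IsPrime.mem_associatedPrimes_or_exists_regular {A : Type*} [CommRing A]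
    [IsNoetherianRing A] {p : Ideal A} (hp : p.IsPrime) :
    p ∈ associatedPrimes A A ∨ ∃ x ∈ p, ∃ u ∉ p, ∀ r, x * r = 0 → u * r = 0 := by
  refine or_iff_not_imp_left.2 fun hpA => ?_
  obtain ⟨x, hxp, hx⟩ : ∃ x ∈ p, ∀ p' ∈ associatedPrimes A A, p' ≤ p → x ∉ p' := by
    by_contra! h
    have hfin : {p' ∈ associatedPrimes A A | p' ≤ p}.Finite :=
      (associatedPrimes.finite A A).subset fun _ h => h.1
    obtain ⟨p', hp', hle⟩ := (Ideal.subset_union_prime_finite hfin (f := id) 0 0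
      fun _ h _ _ => h.1.isPrime).1 (fun x hx => by
        obtain ⟨p', h₁, h₂, h₃⟩ := h x hx
        exact Set.mem_biUnion (show p' ∈ {p' ∈ associatedPrimes A A | p' ≤ p} from ⟨h₁, h₂⟩) h₃)
    exact hpA (le_antisymm hp'.2 hle ▸ hp'.1)
  let N : Submodule A A := LinearMap.ker (LinearMap.mulLeft A x)
  obtain ⟨u, hu, hup⟩ : ∃ u ∈ Module.annihilator A N, u ∉ p := by
    by_contra! hle
    obtain ⟨p', hp', hp'p⟩ := Ideal.exists_minimalPrimes_le (I := Module.annihilator A N) hle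
    have hass := Module.associatedPrimes.minimalPrimes_annihilator_subset_associatedPrimes A N hp'
    refine hx p' (IsAssociatedPrime.map_of_injective N.subtype hass N.injective_subtype) hp'p
      (hp'.1.2 ?_)
    rw [Module.mem_annihilator]
    exact fun r => Subtype.ext r.2
  exact ⟨x, hxp, u, hup, fun r hr => congrArg Subtype.val (Module.mem_annihilator.1 hu ⟨r, hr⟩)⟩


/-- **Scheja–Storch, Lemma 1.4**: if `A` is Noetherian, `B` a finite flat `A`-algebra and `M` a
finite `B`-module which is projective over `A`, and `Hom_B(M, B)` is projective over `B`, then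
`M` is projective over `B`. -/
theorem projective_of_dual_projective {A B M : Type*} [CommRing A] [IsNoetherianRing A]
    [CommRing B] [Algebra A B] [Module.Finite A B] [Module.Flat A B]
    [AddCommGroup M] [Module A M] [Module B M] [IsScalarTower A B M] [Module.Finite B M]
    [Module.Projective A M]
    (h : Module.Projective B (M →ₗ[B] B)) :
    Module.Projective B M := by
  open Module in
  have hB : IsNoetherianRing B := IsNoetherianRing.of_finite A B
  have hMA : Module.Finite A M := Module.Finite.trans B M
  have hproj : Projective B (Dual B M) := h
  have hfin : Module.Finite B (Dual B M) := by
    obtain ⟨n, f, hf⟩ := Module.Finite.exists_fin' B M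
    exact Module.Finite.of_injective f.dualMap (LinearMap.dualMap_injective_of_surjective hf)
  have hreg {q : PrimeSpectrum B} {a : A} (ha : ∀ r, r * a = 0 ↔ algebraMap A B r ∈ q.asIdeal) :
      q ∉ support B (Dual B (Dual B M) ⧸ LinearMap.range (Dual.eval B M)) ∧
        q ∉ support B (LinearMap.ker (Dual.eval B M)) := by
    obtain ⟨s, hs⟩ := exists_colon_eq_of_flat (A := A) q.asIdeal (a := a) (x := 0)
      (by simpa using ha)
    have hC := notMem_support_quotient_range_eval (M := M) q (s := s) (x := 0)
      (by simpa using hs) (.inl rfl)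
    exact ⟨hC, notMem_support_ker_eval q (by simpa using hs) hC⟩
  have hinj : LinearMap.ker (Dual.eval B M) = ⊥ := by
    by_contra hne
    have := Submodule.nontrivial_iff_ne_bot.2 hne
    obtain ⟨q, hq⟩ := associatedPrimes.nonempty B (LinearMap.ker (Dual.eval B M))
    have hq' := IsAssociatedPrime.map_of_injective _ hq (Submodule.injective_subtype _)
    obtain ⟨hqp, ⟨k, hk⟩⟩ := isAssociatedPrime_iff.1 hq
    have hkq (b : B) : b • (k : M) = 0 ↔ b ∈ q := by
      rw [hk, Submodule.mem_colon_singleton, Submodule.mem_bot, ← Submodule.coe_smul,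
        ZeroMemClass.coe_eq_zero]
    obtain ⟨a, ha⟩ := Projective.exists_colon_eq (hqp.comap (algebraMap A B)) (x := 0)
      (z := (k : M)) (fun r => by simp [Ideal.mem_comap, ← hkq, algebraMap_smul])
    refine (hreg (q := ⟨q, hqp⟩) (a := a) (by simpa using ha)).2 ?_
    rw [mem_support_iff']
    exact ⟨k, fun r hr h0 => hr ((hkq r).1 (congrArg Subtype.val h0))⟩
  have hsurj : LinearMap.range (Dual.eval B M) = ⊤ := by
    by_contra hne
    have := Submodule.Quotient.nontrivial_iff.2 hne
    obtain ⟨q, hq⟩ := associatedPrimes.nonempty B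
      (Dual B (Dual B M) ⧸ LinearMap.range (Dual.eval B M))
    obtain ⟨hqp, ⟨y, hy⟩⟩ := isAssociatedPrime_iff.1 hq
    have hyq (b : B) : b • y = 0 ↔ b ∈ q := by
      rw [hy, Submodule.mem_colon_singleton, Submodule.mem_bot]
    have hsupp : ⟨q, hqp⟩ ∈ support B (Dual B (Dual B M) ⧸ LinearMap.range (Dual.eval B M)) := by
      rw [mem_support_iff']
      exact ⟨y, fun r hr h0 => hr ((hyq r).1 h0)⟩
    obtain ⟨l, rfl⟩ := Submodule.Quotient.mk_surjective _ y
    simp only [← Submodule.Quotient.mk_smul, Submodule.Quotient.mk_eq_zero] at hyq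
    obtain hass | ⟨x, hxq, u, huq, hux⟩ :=
      (hqp.comap (algebraMap A B)).mem_associatedPrimes_or_exists_regular
    · obtain ⟨-, a, ha⟩ := isAssociatedPrime_iff.1 hass
      refine (hreg (q := ⟨q, hqp⟩) (a := a) fun r => ?_).1 hsupp
      rw [← Ideal.mem_comap, ha, Submodule.mem_colon_singleton, Submodule.mem_bot, smul_eq_mul]
    have hux' (b : B) (hb : algebraMap A B x * b = 0) : algebraMap A B u * b = 0 := by
      rw [← Algebra.smul_def] at hb ⊢
      exact Flat.smul_eq_zero_of_smul_eq_zero hux hb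
    obtain ⟨z, hz⟩ := (hyq _).2 hxq
    have hzq (r : A) : (∃ m, r • z = x • m) ↔ r ∈ q.comap (algebraMap A B) := by
      rw [Ideal.mem_comap, ← hyq]
      constructor
      · rintro ⟨m, hm⟩
        rw [← algebraMap_smul B r, ← algebraMap_smul B x] at hm
        have hm' := congrArg (Dual.eval B M) hm
        rw [map_smul, map_smul, hz] at hm'
        have hu0 : algebraMap A B u • (algebraMap A B r • l - Dual.eval B M m) = 0 := by
          ext f
          refine hux' _ ?_
          have := LinearMap.congr_fun hm' f
          simp only [LinearMap.smul_apply, LinearMap.sub_apply, smul_eq_mul] at this ⊢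
          linear_combination this
        rw [hyq]
        refine (hqp.mem_or_mem ((hyq _).1 ⟨algebraMap A B u • m, ?_⟩)).resolve_left huq
        rw [map_smul, mul_smul, eq_comm, ← sub_eq_zero]
        exact (smul_sub _ _ _).symm.trans hu0
      · rintro ⟨m, hm⟩
        refine ⟨m, LinearMap.ker_eq_bot.1 hinj ?_⟩
        rw [← algebraMap_smul B r, ← algebraMap_smul B x, map_smul, map_smul, hz, hm, smul_comm]
    obtain ⟨a, ha⟩ := Projective.exists_colon_eq (hqp.comap (algebraMap A B)) hzq
    obtain ⟨s, hs⟩ := exists_colon_eq_of_flat q ha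
    simp only [Algebra.smul_def] at hs
    exact notMem_support_quotient_range_eval ⟨q, hqp⟩ hs (.inr ⟨_, huq, hux'⟩) hsupp
  exact Projective.of_equiv (LinearEquiv.ofBijective (Dual.eval B M)
    ⟨LinearMap.ker_eq_bot.1 hinj, LinearMap.range_eq_top.1 hsurj⟩).symm
end

section
/- Let A be a commutative Noetherian ring, B a finite flat A-algebra, and M a finite B-module that is free as an A-module. If Hom_B(M,B) is a free B-module, then M is a free B-module. -/
open TensorProduct in
/-- Let `B` be a finite flat algebra over a Noetherian ring `A`. If a finite `B`-module `C` has no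
nonzero map to `B ⊗[A] N`, then it is killed by an `N`-regular element of `A`. -/
theorem exists_isSMulRegular_of_subsingleton_linearMap_baseChange {A B C : Type*} (N : Type*)
    [CommRing A] [IsNoetherianRing A] [CommRing B] [Algebra A B] [Module.Finite A B]
    [Module.Flat A B] [AddCommGroup C] [Module A C] [Module B C] [IsScalarTower A B C]
    [Module.Finite B C] [AddCommGroup N] [Module A N] [Module.Finite A N]
    [Subsingleton (C →ₗ[B] B ⊗[A] N)] :
    ∃ a ∈ Module.annihilator A C, IsSMulRegular N a := by
  have : IsNoetherianRing B := IsNoetherianRing.of_finite A B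
  have : Module.Finite A C := Module.Finite.trans B C
  obtain ⟨b, hbC, hb⟩ := IsSMulRegular.subsingleton_linearMap_iff.mp
    ‹Subsingleton (C →ₗ[B] B ⊗[A] N)›
  refine IsSMulRegular.subsingleton_linearMap_iff.mp ⟨fun f g ↦ ?_⟩
  rw [← sub_eq_zero]
  by_contra hfg
  obtain ⟨c, hc⟩ := DFunLike.ne_iff.mp hfg
  obtain ⟨p, hp, hpc⟩ := exists_le_isAssociatedPrime_of_isNoetherianRing A _ hc
  have hCp : (Module.annihilator B C).comap (algebraMap A B) ≤ p := by
    intro a ha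
    refine hpc ?_
    rw [Submodule.mem_colon_singleton, Submodule.mem_bot, ← map_smul, ← algebraMap_smul B a c,
      Module.mem_annihilator.mp ha c, map_zero]
  have := hp.isPrime
  obtain ⟨q, hq, hqp, rfl⟩ := Ideal.exists_ideal_over_prime_of_isIntegral p _ hCp
  obtain ⟨-, i, hi⟩ := (isAssociatedPrime_iff_exists_injective_linearMap _ _).mp hp
  have hmin : q ∈ (Module.annihilator B
      (B ⧸ (q.comap (algebraMap A B)).map (algebraMap A B))).minimalPrimes := by
    rw [Ideal.annihilator_quotient]
    exact Ideal.IsIntegral.mem_minimalPrimes_map_under q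
  have hqN : IsAssociatedPrime q (B ⊗[A] N) := by
    have hqB : IsAssociatedPrime q (B ⧸ (q.comap (algebraMap A B)).map (algebraMap A B)) :=
      Module.associatedPrimes.minimalPrimes_annihilator_subset_associatedPrimes _ _ hmin
    refine (hqB.map_of_injective _ (Ideal.qoutMapEquivTensorQout B).injective).map_of_injective
      (i.baseChange B) ?_
    exact Module.Flat.lTensor_preserves_injective_linearMap i hi
  have : b ∈ ⋃ p ∈ associatedPrimes B (B ⊗[A] N), (p : Set B) :=
    Set.mem_iUnion₂_of_mem hqN (hq hbC)
  rw [biUnion_associatedPrimes_eq_zero_divisors] at this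
  obtain ⟨x, hx, hbx⟩ := this
  exact hx (hb.right_eq_zero_of_smul hbx)

open TensorProduct in
/-- The element `m ⊗ 1` of `M ⊗ A / (a)` vanishes exactly when `m` lies in `a M`. -/
theorem tmul_one_quotient_span_singleton_eq_zero_iff {A M : Type*} [CommRing A] [AddCommGroup M]
    [Module A M] (a : A) (m : M) :
    m ⊗ₜ[A] (1 : A ⧸ Ideal.span {a}) = 0 ↔ ∃ m' : M, a • m' = m := by
  rw [← TensorProduct.tensorQuotEquivQuotSMul_symm_mk, LinearEquiv.map_eq_zero_iff,
    Submodule.Quotient.mk_eq_zero, Submodule.ideal_span_singleton_smul,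
    Submodule.mem_smul_pointwise_iff_exists]
  simp

/-- Flat modules are torsion-free with respect to regular elements of the base ring. -/
theorem IsSMulRegular.of_flat_module {A : Type*} (M : Type*) [CommRing A] [AddCommGroup M]
    [Module A M] [Module.Flat A M] {a : A} (ha : IsSMulRegular A a) : IsSMulRegular M a := by
  have := Module.Flat.lTensor_preserves_injective_linearMap (M := M) (LinearMap.lsmul A A a) ha
  intro x y hxy
  have hxy : a • x = a • y := hxy
  have := @this (x ⊗ₜ 1) (y ⊗ₜ 1) (by
    simp only [LinearMap.lTensor_tmul, LinearMap.lsmul_apply, ← TensorProduct.smul_tmul, hxy])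
  simpa using congrArg (TensorProduct.rid A M) this

open TensorProduct in
/-- If `a'` is regular on `A / (a)` and `M` is flat, then `a'` is regular on `M / a M`. -/
theorem exists_smul_eq_of_smul_eq_smul {A M : Type*} [CommRing A] [AddCommGroup M]
    [Module A M] [Module.Flat A M] {a a' : A} (ha' : IsSMulRegular (A ⧸ Ideal.span {a}) a')
    {m m' : M} (h : a' • m = a • m') : ∃ m'' : M, a • m'' = m := by
  rw [← tmul_one_quotient_span_singleton_eq_zero_iff]
  have := Module.Flat.lTensor_preserves_injective_linearMap (M := M)
    (LinearMap.lsmul A (A ⧸ Ideal.span {a}) a') ha'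
  refine this ?_
  have h0 := (tmul_one_quotient_span_singleton_eq_zero_iff a (a' • m)).mpr ⟨m', h.symm⟩
  rw [map_zero, ← h0, LinearMap.lTensor_tmul, LinearMap.lsmul_apply, TensorProduct.smul_tmul]

/-- A finite module over a finite flat `A`-algebra whose dual vanishes is killed by a regular
element of `A`. -/
theorem exists_isSMulRegular_of_subsingleton_dual {A : Type*} (B : Type*) {N : Type*}
    [CommRing A] [IsNoetherianRing A]
    [CommRing B] [Algebra A B] [Module.Finite A B] [Module.Flat A B]
    [AddCommGroup N] [Module A N] [Module B N] [IsScalarTower A B N] [Module.Finite B N]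
    [Subsingleton (Module.Dual B N)] :
    ∃ a ∈ Module.annihilator A N, IsSMulRegular A a := by
  have : Subsingleton (N →ₗ[B] TensorProduct A B A) :=
    (LinearEquiv.congrRight (M := N)
      (TensorProduct.AlgebraTensorModule.rid A B B)).toEquiv.subsingleton
  exact exists_isSMulRegular_of_subsingleton_linearMap_baseChange (B := B) A

/-- The cokernel of a map whose dual is injective is killed by a regular element of `A`. -/
theorem exists_isSMulRegular_annihilator_quotient_range {A B M N : Type*}
    [CommRing A] [IsNoetherianRing A]
    [CommRing B] [Algebra A B] [Module.Finite A B] [Module.Flat A B]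
    [AddCommGroup M] [Module B M] [AddCommGroup N] [Module A N] [Module B N]
    [IsScalarTower A B N] [Module.Finite B N] {φ : M →ₗ[B] N}
    (hφ : Function.Injective φ.dualMap) :
    ∃ a ∈ Module.annihilator A (N ⧸ φ.range), IsSMulRegular A a := by
  have : Subsingleton (Module.Dual B (N ⧸ φ.range)) := by
    refine subsingleton_of_forall_eq 0 fun g ↦ ?_
    have : g ∘ₗ φ.range.mkQ = 0 := hφ <| by
      ext m
      simp [(Submodule.Quotient.mk_eq_zero φ.range).mpr (φ.mem_range_self m)]
    exact Submodule.linearMap_qext _ (by simpa using this)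
  exact exists_isSMulRegular_of_subsingleton_dual B

/-- Let `B` be a finite flat algebra over a Noetherian ring `A`, let `M` be a finite `B`-module
which is flat over `A`, and let `N` be a finite projective `B`-module. If the `B`-dual of a map
`M → N` is bijective, then the map is injective. -/
theorem LinearMap.injective_of_dualMap_bijective (A : Type*) {B M N : Type*}
    [CommRing A] [IsNoetherianRing A]
    [CommRing B] [Algebra A B] [Module.Finite A B] [Module.Flat A B]
    [AddCommGroup M] [Module A M] [Module B M] [IsScalarTower A B M] [Module.Finite B M]
    [Module.Flat A M] [AddCommGroup N] [Module A N] [Module B N] [IsScalarTower A B N]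
    [Module.Finite B N] [Module.Projective B N] {φ : M →ₗ[B] N}
    (hφ : Function.Bijective φ.dualMap) : Function.Injective φ := by
  have : IsNoetherianRing B := IsNoetherianRing.of_finite A B
  obtain ⟨a, haC, ha⟩ := exists_isSMulRegular_annihilator_quotient_range (A := A) hφ.1
  have haN (n : N) : algebraMap A B a • n ∈ φ.range := by
    rw [← Submodule.Quotient.mk_eq_zero, Submodule.Quotient.mk_smul, algebraMap_smul]
    exact Module.mem_annihilator.mp haC _
  obtain ⟨s, hs⟩ := Module.projective_lifting_property φ.rangeRestrict
    ((algebraMap A B a • LinearMap.id (M := N)).codRestrict φ.range haN)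
    φ.surjective_rangeRestrict
  have hs (n : N) : φ (s n) = algebraMap A B a • n :=
    congrArg Subtype.val (LinearMap.congr_fun hs n)
  let π : M →ₗ[B] φ.ker := (algebraMap A B a • LinearMap.id - s ∘ₗ φ).codRestrict φ.ker
    fun m ↦ by simp [hs]
  have hπ (k : φ.ker) : π k = algebraMap A B a • k := by
    ext
    simp [π]
  have : Subsingleton (Module.Dual B φ.ker) := by
    refine subsingleton_of_forall_eq 0 fun g ↦ LinearMap.ext fun k ↦ ?_
    obtain ⟨h, hh⟩ := hφ.2 (g ∘ₗ π)
    have := LinearMap.congr_fun hh k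
    simp only [LinearMap.dualMap_apply, LinearMap.map_coe_ker, map_zero, LinearMap.comp_apply,
      hπ, algebraMap_smul, LinearMap.map_smul_of_tower] at this
    exact (ha.of_flat_module B).right_eq_zero_of_smul this.symm
  obtain ⟨a', ha'K, ha'⟩ := exists_isSMulRegular_of_subsingleton_dual (A := A) B (N := φ.ker)
  refine (injective_iff_map_eq_zero φ).mpr fun m hm ↦ ?_
  have := congrArg Subtype.val (Module.mem_annihilator.mp ha'K ⟨m, hm⟩)
  exact (ha'.of_flat_module M).right_eq_zero_of_smul this

/-- Let `B` be a finite flat algebra over a Noetherian ring `A`, let `M` be a finite `B`-module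
which is flat over `A`, and let `N` be a finite projective `B`-module. If the `B`-dual of a map
`M → N` is bijective, then the map is surjective. -/
theorem LinearMap.surjective_of_dualMap_bijective (A : Type*) {B M N : Type*}
    [CommRing A] [IsNoetherianRing A]
    [CommRing B] [Algebra A B] [Module.Finite A B] [Module.Flat A B]
    [AddCommGroup M] [Module A M] [Module B M] [IsScalarTower A B M] [Module.Finite B M]
    [Module.Flat A M] [AddCommGroup N] [Module A N] [Module B N] [IsScalarTower A B N]
    [Module.Finite B N] [Module.Projective B N] {φ : M →ₗ[B] N}
    (hφ : Function.Bijective φ.dualMap) : Function.Surjective φ := by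
  have hinj := LinearMap.injective_of_dualMap_bijective A hφ
  have : Module.Flat A N := Module.Flat.trans A B N
  obtain ⟨a, haC, ha⟩ := exists_isSMulRegular_annihilator_quotient_range (A := A) hφ.1
  let τ : B →ₗ[B] TensorProduct A B (A ⧸ Ideal.span {a}) :=
    LinearMap.toSpanSingleton B _ (1 ⊗ₜ 1)
  have hτ (b : B) : τ b = b ⊗ₜ 1 := by simp [τ, TensorProduct.smul_tmul']
  have hτ_surj : Function.Surjective τ := by
    intro x
    induction x with
    | zero => exact ⟨0, map_zero _⟩
    | add x y hx hy =>
      obtain ⟨b, rfl⟩ := hx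
      obtain ⟨c, rfl⟩ := hy
      exact ⟨b + c, map_add _ _ _⟩
    | tmul b r =>
      obtain ⟨r, rfl⟩ := Ideal.Quotient.mk_surjective r
      refine ⟨r • b, ?_⟩
      rw [hτ, TensorProduct.smul_tmul, ← Ideal.Quotient.algebraMap_eq,
        Algebra.algebraMap_eq_smul_one]
  have haB := ha.of_flat_module B
  have : Subsingleton ((N ⧸ φ.range) →ₗ[B] TensorProduct A B (A ⧸ Ideal.span {a})) := by
    refine subsingleton_of_forall_eq 0 fun g ↦ ?_
    obtain ⟨h, hh⟩ := Module.projective_lifting_property τ (g ∘ₗ φ.range.mkQ) hτ_surj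
    have hdiv (m : M) : ∃ b : B, a • b = h (φ m) := by
      refine (tmul_one_quotient_span_singleton_eq_zero_iff a _).mp ?_
      rw [← hτ]
      refine (LinearMap.congr_fun hh (φ m)).trans ?_
      simp [(Submodule.Quotient.mk_eq_zero φ.range).mpr (φ.mem_range_self m)]
    choose k hk using hdiv
    let k' : M →ₗ[B] B :=
      { toFun := k
        map_add' := fun x y ↦ haB (by simp [hk])
        map_smul' := fun b x ↦ haB (by
          change a • k (b • x) = a • (b • k x)
          rw [smul_comm, hk, hk, map_smul, map_smul]) }
    obtain ⟨l, hl⟩ := hφ.2 k'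
    have hhl : h = algebraMap A B a • l := hφ.1 <| by
      ext m
      rw [map_smul, hl, LinearMap.dualMap_apply, LinearMap.smul_apply, algebraMap_smul]
      exact (hk m).symm
    refine Submodule.linearMap_qext _ (LinearMap.ext fun n ↦ ?_)
    refine (LinearMap.congr_fun hh n).symm.trans ?_
    rw [LinearMap.comp_apply, hτ, hhl]
    exact (tmul_one_quotient_span_singleton_eq_zero_iff a _).mpr ⟨l n, by simp⟩
  obtain ⟨a', ha'C, ha'⟩ := exists_isSMulRegular_of_subsingleton_linearMap_baseChange (A := A)
    (B := B) (C := N ⧸ φ.range) (A ⧸ Ideal.span {a})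
  intro n
  have hmem {c : A} (hc : c ∈ Module.annihilator A (N ⧸ φ.range)) : ∃ m, φ m = c • n := by
    rw [← LinearMap.mem_range, ← Submodule.Quotient.mk_eq_zero, Submodule.Quotient.mk_smul]
    exact Module.mem_annihilator.mp hc _
  obtain ⟨m, hm⟩ := hmem haC
  obtain ⟨m', hm'⟩ := hmem ha'C
  have hsmul (c : A) (x : M) : φ (c • x) = c • φ x := φ.map_smul_of_tower c x
  obtain ⟨m'', rfl⟩ := exists_smul_eq_of_smul_eq_smul ha' (m := m) (m' := m') <| hinj <| by
    rw [hsmul, hsmul, hm, hm', smul_comm]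
  exact ⟨m'', ha.of_flat_module N (by simpa [hsmul] using hm)⟩

/-- **Scheja–Storch, Lemma 1.4, free version**: if `A` is Noetherian, `B` a finite flat
`A`-algebra and `M` a finite `B`-module which is free over `A`, and `Hom_B(M, B)` is free over
`B`, then `M` is free over `B`. -/
theorem free_of_dual_free {A B M : Type*} [CommRing A] [IsNoetherianRing A]
    [CommRing B] [Algebra A B] [Module.Finite A B] [Module.Flat A B]
    [AddCommGroup M] [Module A M] [Module B M] [IsScalarTower A B M] [Module.Finite B M]
    [Module.Free A M]
    (h : Module.Free B (M →ₗ[B] B)) :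
    Module.Free B M := by
  have : IsNoetherianRing B := IsNoetherianRing.of_finite A B
  have : Module.Free B (Module.Dual B M) := h
  let N := Module.Dual B (Module.Dual B M)
  have hdual : Function.Bijective (Module.Dual.eval B M).dualMap := by
    refine (Module.bijective_dual_eval B (Module.Dual B M)).of_comp_iff _ |>.mp ?_
    exact Function.bijective_id
  exact Module.Free.of_equiv (LinearEquiv.ofBijective (Module.Dual.eval B M)
    ⟨LinearMap.injective_of_dualMap_bijective A (N := N) hdual,
      LinearMap.surjective_of_dualMap_bijective A (N := N) hdual⟩).symm
end

section
/- Let A be a commutative Noetherian ring and B = A[x₁,…,xₙ]/(f₁,…,fₙ) a finite flat A-algebra with quotient map π. Suppose (a_ij) and (b_ij) are two n×n matrices over A[x₁,…,xₙ] ⊗_A A[x₁,…,xₙ] such that f_j⊗1 − 1⊗f_j = Σ_i a_ij (x_i⊗1 − 1⊗x_i) and f_j⊗1 − 1⊗f_j = Σ_i b_ij (x_i⊗1 − 1⊗x_i) for all j. Then (π⊗π)(det(a_ij)) = (π⊗π)(det(b_ij)) in B ⊗_A B; that is, the element Δ := (π⊗π)(det(a_ij)) is independent of the choice of coefficient matrix.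 -/
open TensorProduct

/-- A sequence annihilated by the Koszul relations of a permutably regular family kills all its
syzygies: if `∑ cᵢ dᵢ = 0` and `φ(dₖ) wₗ = φ(dₗ) wₖ`, then `∑ φ(cᵢ) wᵢ = 0`. -/
theorem sum_map_mul_eq_zero_of_syzygy {R S ι : Type*} [CommRing R] [CommRing S] (φ : R →+* S)
    (d : ι → R)
    (hd : ∀ (s : Finset ι) (k : ι), k ∉ s → ∀ c, c * d k ∈ Ideal.span (d '' s) →
      c ∈ Ideal.span (d '' s))
    (w : ι → S) (hw : ∀ k l, φ (d k) * w l = φ (d l) * w k) (s : Finset ι) (c : ι → R)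
    (hc : ∑ i ∈ s, c i * d i = 0) : ∑ i ∈ s, φ (c i) * w i = 0 := by
  classical
  induction s using Finset.induction_on generalizing c with
  | empty => simp
  | insert k s hk ih =>
    rw [Finset.sum_insert hk] at hc ⊢
    have hmem : c k ∈ Ideal.span (d '' s) := by
      refine hd s k hk _ ?_
      rw [eq_neg_of_add_eq_zero_left hc]
      exact neg_mem (sum_mem fun i hi ↦
        Ideal.mul_mem_left _ _ (Ideal.subset_span ⟨i, hi, rfl⟩))
    obtain ⟨t, ht⟩ := (Submodule.mem_span_image_finset_iff_exists_fun' R).1 hmem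
    simp only [smul_eq_mul] at ht
    have key := ih (fun i ↦ c i + t i * d k) (by
      rw [← hc, ← ht, Finset.sum_mul, ← Finset.sum_add_distrib]
      exact Finset.sum_congr rfl fun i _ ↦ by ring)
    rw [← key, ← ht, map_sum, Finset.sum_mul, ← Finset.sum_add_distrib]
    refine Finset.sum_congr rfl fun i _ ↦ ?_
    simp only [map_mul, map_add]
    linear_combination (-φ (t i)) * hw k i

/-- If the row vector `d` annihilates every column of `M` except possibly column `j`, then the
cofactors of column `j` are proportional to `d`. -/
theorem Matrix.mul_adjugate_comm_of_vecMul {S ι : Type*} [CommRing S] [Fintype ι] [DecidableEq ι]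
    (M : Matrix ι ι S) (d : ι → S) (j : ι) (h : ∀ m, m ≠ j → ∑ i, d i * M i m = 0) (k l : ι) :
    d k * M.adjugate j l = d l * M.adjugate j k := by
  set N := M.updateCol j (Pi.single k 1) with hN
  have hadj : ∀ (P : Matrix ι ι S) l, P.adjugate j l = (P.updateCol j (Pi.single l 1)).det :=
    fun P l ↦ by rw [← Matrix.cramer_apply, Matrix.cramer_eq_adjugate_mulVec]; simp
  have hrow : ∀ l, N.adjugate j l = M.adjugate j l := fun l ↦ by simp [hadj, hN]
  have hdet : N.det = M.adjugate j k := (hadj M k).symm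
  have hvec : Matrix.vecMul d N = Pi.single j (d k) := by
    ext m
    by_cases hm : m = j
    · subst hm
      simp [hN, Matrix.vecMul, dotProduct, Pi.single_apply]
    · simp [hN, Matrix.vecMul, dotProduct, hm, h m hm]
  have := congrFun (congrArg (fun v ↦ Matrix.vecMul v N.adjugate) hvec) l
  simp only [Matrix.vecMul_vecMul, Matrix.mul_adjugate] at this
  simp [Matrix.vecMul_smul, hdet, hrow] at this
  rw [← this, mul_comm]

theorem map_det_updateCol_eq {R S ι : Type*} [CommRing R] [CommRing S] [Fintype ι]
    [DecidableEq ι] (φ : R →+* S) (d : ι → R)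
    (hd : ∀ (s : Finset ι) (k : ι), k ∉ s → ∀ c, c * d k ∈ Ideal.span (d '' s) →
      c ∈ Ideal.span (d '' s))
    (M : Matrix ι ι R) (hM : ∀ j, φ (∑ i, M i j * d i) = 0) (j : ι) (v : ι → R)
    (hv : ∑ i, v i * d i = ∑ i, M i j * d i) : φ (M.updateCol j v).det = φ M.det := by
  have hw := Matrix.mul_adjugate_comm_of_vecMul (φ.mapMatrix M) (φ ∘ d) j fun m _ ↦ by
    simpa [mul_comm] using hM m
  have key := sum_map_mul_eq_zero_of_syzygy φ d hd _ hw Finset.univ (fun i ↦ v i - M i j)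
    (by simp [sub_mul, hv])
  have hdet : ∀ u : ι → R,
      φ (M.updateCol j u).det = ∑ i, φ (u i) * (φ.mapMatrix M).adjugate j i := fun u ↦ by
    rw [← Matrix.cramer_apply, Matrix.cramer_eq_adjugate_mulVec, ← RingHom.map_adjugate]
    simp [Matrix.mulVec, dotProduct, mul_comm]
  have hself := hdet fun i ↦ M i j
  rw [show M.updateCol j (fun i ↦ M i j) = M from Matrix.updateCol_eq_self M j] at hself
  rw [hself, hdet, ← sub_eq_zero, ← Finset.sum_sub_distrib, ← key]
  simp [sub_mul]

/-- Two matrices expressing the same family in terms of a permutably regular family `d` have the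
same determinant modulo that family. -/
theorem map_det_eq_of_sum_mul_eq {R S ι : Type*} [CommRing R] [CommRing S] [Fintype ι]
    [DecidableEq ι] (φ : R →+* S) (d : ι → R)
    (hd : ∀ (s : Finset ι) (k : ι), k ∉ s → ∀ c, c * d k ∈ Ideal.span (d '' s) →
      c ∈ Ideal.span (d '' s))
    (a b : Matrix ι ι R) (ha : ∀ j, φ (∑ i, a i j * d i) = 0)
    (hab : ∀ j, ∑ i, a i j * d i = ∑ i, b i j * d i) : φ a.det = φ b.det := by
  let N : Finset ι → Matrix ι ι R := fun s ↦ Matrix.of fun i j ↦ if j ∈ s then b i j else a i j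
  have hN : ∀ s j, ∑ i, N s i j * d i = ∑ i, a i j * d i := fun s j ↦ by
    by_cases hj : j ∈ s <;> simp [N, hj, hab]
  have main : ∀ s, φ (N s).det = φ a.det := fun s ↦ by
    induction s using Finset.induction_on with
    | empty => rfl
    | insert k s hk ih =>
      rw [← ih, ← map_det_updateCol_eq φ d hd (N s) (fun j ↦ by rw [hN, ha]) k
        (fun i ↦ b i k) (by rw [hN, hab])]
      congr 2
      ext i j
      by_cases hj : j = k
      · subst hj; simp [N]
      · simp [N, hj]
  rw [← main Finset.univ]
  congr 2
  ext i j
  simp [N]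

theorem MvPolynomial.mem_span_X_image_of_mul_X_mem {σ B : Type*} [CommRing B] (s : Set σ) (k : σ)
    (hk : k ∉ s) (c : MvPolynomial σ B)
    (hc : c * X k ∈ Ideal.span ((X : σ → MvPolynomial σ B) '' s)) :
    c ∈ Ideal.span ((X : σ → MvPolynomial σ B) '' s) := by
  rw [MvPolynomial.mem_ideal_span_X_image] at hc ⊢
  intro m hm
  obtain ⟨i, hi, h⟩ := hc (m + Finsupp.single k 1) (by
    rw [MvPolynomial.mem_support_iff] at hm ⊢
    rwa [MvPolynomial.coeff_mul_X])
  refine ⟨i, hi, ?_⟩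
  have : k ≠ i := fun h ↦ hk (h ▸ hi)
  simpa [Finsupp.single_apply, this] using h

/-- The substitution `Xᵢ ↦ bᵢ - Xᵢ` as an involution of the polynomial ring. -/
noncomputable def MvPolynomial.reflectEquiv {σ B : Type*} [CommRing B] (b : σ → B) :
    MvPolynomial σ B ≃ₐ[B] MvPolynomial σ B :=
  AlgEquiv.ofAlgHom (aeval fun i ↦ C (b i) - X i) (aeval fun i ↦ C (b i) - X i)
    (by ext i; simp) (by ext i; simp)

/-- The elements `xᵢ ⊗ 1 - 1 ⊗ xᵢ` are the variables of `A[x] ⊗ A[x]` as a polynomial ring over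
its left factor. -/
theorem MvPolynomial.exists_ringEquiv_tmul_sub_tmul {σ A : Type*} [CommRing A] :
    ∃ e : (MvPolynomial σ A ⊗[A] MvPolynomial σ A) ≃+* MvPolynomial σ (MvPolynomial σ A),
      ∀ i, e (X i ⊗ₜ[A] 1 - 1 ⊗ₜ[A] X i) = X i := by
  refine ⟨(algebraTensorAlgEquiv A (MvPolynomial σ A)).toRingEquiv.trans
    (reflectEquiv (X : σ → MvPolynomial σ A)).toRingEquiv, fun i ↦ ?_⟩
  simp [reflectEquiv, algebraTensorAlgEquiv_tmul, Algebra.smul_def]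

theorem MvPolynomial.mem_span_tmul_sub_tmul_of_mul_mem {σ A : Type*} [CommRing A] (s : Set σ)
    (k : σ) (hk : k ∉ s) (c : MvPolynomial σ A ⊗[A] MvPolynomial σ A)
    (hc : c * (X k ⊗ₜ[A] 1 - 1 ⊗ₜ[A] X k) ∈ Ideal.span
      ((fun i : σ ↦ (X i ⊗ₜ[A] 1 - 1 ⊗ₜ[A] X i : MvPolynomial σ A ⊗[A] MvPolynomial σ A)) '' s)) :
    c ∈ Ideal.span
      ((fun i : σ ↦ (X i ⊗ₜ[A] 1 - 1 ⊗ₜ[A] X i : MvPolynomial σ A ⊗[A] MvPolynomial σ A)) '' s) := by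
  obtain ⟨e, he⟩ := exists_ringEquiv_tmul_sub_tmul (σ := σ) (A := A)
  have hmap : (Ideal.span ((fun i : σ ↦
      (X i ⊗ₜ[A] 1 - 1 ⊗ₜ[A] X i : MvPolynomial σ A ⊗[A] MvPolynomial σ A)) '' s)).map e =
      Ideal.span ((X : σ → MvPolynomial σ (MvPolynomial σ A)) '' s) := by
    rw [Ideal.map_span, Set.image_image]
    simp only [he]
  have h := Ideal.mem_map_of_mem e hc
  rw [hmap, map_mul, he] at h
  have h' := mem_span_X_image_of_mul_X_mem s k hk _ h
  rw [← hmap] at h'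
  obtain ⟨y, hy, hye⟩ := (Ideal.mem_map_of_equiv e _).1 h'
  rwa [← e.injective hye]

/-- **Well-definedness of `Δ`**: for a presentation `B = A[x₁,…,xₙ]/(f₁,…,fₙ)` of a finite flat
`A`-algebra, the image `Δ = (π⊗π)(det aᵢⱼ)` in `B ⊗_A B` of the determinant of a matrix
`(aᵢⱼ)` with `fⱼ⊗1 - 1⊗fⱼ = ∑ᵢ aᵢⱼ (xᵢ⊗1 - 1⊗xᵢ)` does not depend on the choice of the
matrix. -/
theorem delta_well_defined {A : Type*} [CommRing A] [IsNoetherianRing A] {n : ℕ}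
    (f : Fin n → MvPolynomial (Fin n) A)
    [Module.Finite A (MvPolynomial (Fin n) A ⧸ Ideal.span (Set.range f))]
    [Module.Flat A (MvPolynomial (Fin n) A ⧸ Ideal.span (Set.range f))]
    (a b : Matrix (Fin n) (Fin n)
      (TensorProduct A (MvPolynomial (Fin n) A) (MvPolynomial (Fin n) A)))
    (ha : ∀ j, (f j) ⊗ₜ[A] 1 - 1 ⊗ₜ[A] (f j) =
      ∑ i, a i j * ((MvPolynomial.X i) ⊗ₜ[A] 1 - 1 ⊗ₜ[A] (MvPolynomial.X i)))
    (hb : ∀ j, (f j) ⊗ₜ[A] 1 - 1 ⊗ₜ[A] (f j) =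
      ∑ i, b i j * ((MvPolynomial.X i) ⊗ₜ[A] 1 - 1 ⊗ₜ[A] (MvPolynomial.X i))) :
    Algebra.TensorProduct.map
        (Ideal.Quotient.mkₐ A (Ideal.span (Set.range f)))
        (Ideal.Quotient.mkₐ A (Ideal.span (Set.range f))) a.det =
      Algebra.TensorProduct.map
        (Ideal.Quotient.mkₐ A (Ideal.span (Set.range f)))
        (Ideal.Quotient.mkₐ A (Ideal.span (Set.range f))) b.det := by
  have hreg (s : Finset (Fin n)) (k : Fin n) (hk : k ∉ s) :=
    MvPolynomial.mem_span_tmul_sub_tmul_of_mul_mem (A := A) (s : Set (Fin n)) k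
      (by simpa using hk)
  have key := map_det_eq_of_sum_mul_eq
    (S := (MvPolynomial (Fin n) A ⧸ Ideal.span (Set.range f)) ⊗[A]
      (MvPolynomial (Fin n) A ⧸ Ideal.span (Set.range f))) (Algebra.TensorProduct.map
    (Ideal.Quotient.mkₐ A (Ideal.span (Set.range f)))
    (Ideal.Quotient.mkₐ A (Ideal.span (Set.range f)))).toRingHom _ hreg a b
  refine key (fun j ↦ ?_) (fun j ↦ by rw [← ha, ← hb])
  have hf : Ideal.Quotient.mk (Ideal.span (Set.range f)) (f j) = 0 :=
    Ideal.Quotient.eq_zero_iff_mem.2 (Ideal.subset_span ⟨j, rfl⟩)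
  rw [← ha]
  simp [hf]
end

section
/- Let A be a commutative Noetherian ring and B = A[x₁,…,xₙ]/(f₁,…,fₙ) a finite flat A-algebra with quotient map π. Let (a_ij) be a matrix over A[x₁,…,xₙ]⊗_A A[x₁,…,xₙ] with f_j⊗1 − 1⊗f_j = Σ_i a_ij (x_i⊗1 − 1⊗x_i), set Δ = (π⊗π)(det(a_ij)) ∈ B⊗_A B, and let I be the kernel of the multiplication map m: B⊗_A B → B. Then (Δ) = Ann_{B⊗_A B}(I) and Ann_{B⊗_A B}(Δ) = I, where (Δ) is the principal ideal generated by Δ. -/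
open TensorProduct

set_option synthInstance.maxHeartbeats 4000000
set_option maxHeartbeats 4000000

theorem rTensor_lid_one_tmul_mul {A B : Type*} [CommRing A] [CommRing B] [Algebra A B]
    (l : B →ₗ[A] A) (b : B) (z : B ⊗[A] B) :
    TensorProduct.lid A B (l.rTensor B ((1 ⊗ₜ b) * z)) =
      b * TensorProduct.lid A B (l.rTensor B z) := by
  induction z with
  | zero => simp
  | add x y hx hy => simp only [mul_add, map_add, hx, hy]
  | tmul x y => simp

section Frobenius

variable {A B : Type*} [CommRing A] [CommRing B] [Algebra A B]

theorem mul_eq_one_tmul_lmul'_mul {d : B ⊗[A] B}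
    (hd : ∀ b : B, (b ⊗ₜ[A] (1 : B)) * d = ((1 : B) ⊗ₜ[A] b) * d) (z : B ⊗[A] B) :
    z * d = ((1 : B) ⊗ₜ[A] (Algebra.TensorProduct.lmul' A (S := B) z)) * d := by
  induction z with
  | zero => simp
  | add x y hx hy => rw [add_mul, hx, hy, map_add, tmul_add, add_mul]
  | tmul x y =>
    have h : x ⊗ₜ[A] y = ((1 : B) ⊗ₜ[A] y) * (x ⊗ₜ[A] (1 : B)) := by simp
    rw [h, mul_assoc, hd, ← mul_assoc]
    simp [mul_comm]

theorem mem_annihilator_ker_lmul'_iff (w : B ⊗[A] B) :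
    w ∈ Submodule.annihilator (RingHom.ker (Algebra.TensorProduct.lmul' A (S := B))) ↔
      ∀ b : B, (b ⊗ₜ[A] (1 : B)) * w = ((1 : B) ⊗ₜ[A] b) * w := by
  rw [Submodule.mem_annihilator]
  constructor
  · intro h b
    have := h (b ⊗ₜ[A] (1 : B) - (1 : B) ⊗ₜ[A] b) (by simp [RingHom.mem_ker])
    rw [smul_eq_mul, mul_sub, sub_eq_zero] at this
    rw [mul_comm, this, mul_comm]
  · intro h z hz
    rw [RingHom.mem_ker] at hz
    rw [smul_eq_mul, mul_comm, mul_eq_one_tmul_lmul'_mul h, hz]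
    simp

/-- The contraction of `z` by the form `p ↦ l (p * -)` applied to the left factor. -/
noncomputable def mulContraction (l : B →ₗ[A] A) : B ⊗[A] B →ₗ[A] B →ₗ[A] B :=
  TensorProduct.lift
    (LinearMap.mk₂ A (fun u v => (l ∘ₗ LinearMap.mul A B u).smulRight v)
      (fun u u' v => by ext p; simp [add_smul])
      (fun c u v => by ext p; simp [mul_smul])
      (fun u v v' => by ext p; simp)
      (fun c u v => by ext p; simp [smul_comm c]))

theorem mulContraction_apply (l : B →ₗ[A] A) (z : B ⊗[A] B) (p : B) :
    mulContraction l z p = TensorProduct.lid A B (l.rTensor B ((p ⊗ₜ 1) * z)) := by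
  induction z with
  | zero => simp
  | add x y hx hy => simp only [mul_add, map_add, LinearMap.add_apply, hx, hy]
  | tmul x y => simp [mulContraction, mul_comm]

theorem rTensor_mulContraction (l : B →ₗ[A] A) {w : B ⊗[A] B}
    (hw : ∀ b : B, (b ⊗ₜ[A] (1 : B)) * w = ((1 : B) ⊗ₜ[A] b) * w) (z : B ⊗[A] B) :
    (mulContraction l z).rTensor B w =
      ((1 : B) ⊗ₜ[A] TensorProduct.lid A B (l.rTensor B w)) * TensorProduct.comm A B B z := by
  induction z with
  | zero => simp
  | add x y hx hy =>
    simp only [mul_add, map_add, LinearMap.rTensor_add, LinearMap.add_apply, hx, hy]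
  | tmul u v =>
    have key : ∀ w : B ⊗[A] B, (mulContraction l (u ⊗ₜ v)).rTensor B w =
        v ⊗ₜ TensorProduct.lid A B (l.rTensor B ((u ⊗ₜ 1) * w)) := by
      intro w
      induction w with
      | zero => simp
      | add x y hx hy => simp only [mul_add, map_add, hx, hy, tmul_add]
      | tmul p q => simp [mulContraction, smul_tmul]
    rw [key, hw, rTensor_lid_one_tmul_mul]
    simp [mul_comm]

theorem eq_one_tmul_mul_of_contraction_eq_one {d : B ⊗[A] B}
    (hd : ∀ b : B, (b ⊗ₜ[A] (1 : B)) * d = ((1 : B) ⊗ₜ[A] b) * d) {l : B →ₗ[A] A}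
    (hl : TensorProduct.lid A B (l.rTensor B d) = 1) {w : B ⊗[A] B}
    (hw : ∀ b : B, (b ⊗ₜ[A] (1 : B)) * w = ((1 : B) ⊗ₜ[A] b) * w) :
    w = ((1 : B) ⊗ₜ[A] TensorProduct.lid A B (l.rTensor B w)) * d := by
  have hid : mulContraction l d = LinearMap.id := by
    ext p
    rw [mulContraction_apply, hd, rTensor_lid_one_tmul_mul, hl, mul_one, LinearMap.id_apply]
  have h1 := rTensor_mulContraction l hd d
  have h2 := rTensor_mulContraction l hw d
  rw [hid, LinearMap.rTensor_id, LinearMap.id_apply] at h1 h2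
  rw [hl, ← Algebra.TensorProduct.one_def, one_mul] at h1
  rwa [← h1] at h2

theorem span_eq_annihilator_and_torsionOf_eq_ker {d : B ⊗[A] B}
    (hd : ∀ b : B, (b ⊗ₜ[A] (1 : B)) * d = ((1 : B) ⊗ₜ[A] b) * d) {l : B →ₗ[A] A}
    (hl : TensorProduct.lid A B (l.rTensor B d) = 1) :
    Ideal.span {d} =
      Submodule.annihilator (RingHom.ker (Algebra.TensorProduct.lmul' A (S := B))) ∧
    Ideal.torsionOf _ _ d = RingHom.ker (Algebra.TensorProduct.lmul' A (S := B)) := by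
  constructor
  · apply le_antisymm
    · rw [Ideal.span_singleton_le_iff_mem]
      exact (mem_annihilator_ker_lmul'_iff d).2 hd
    · intro w hw
      rw [Ideal.mem_span_singleton']
      exact ⟨_, (eq_one_tmul_mul_of_contraction_eq_one hd hl
        ((mem_annihilator_ker_lmul'_iff w).1 hw)).symm⟩
  · ext z
    rw [Ideal.mem_torsionOf_iff, smul_eq_mul, mul_eq_one_tmul_lmul'_mul hd, RingHom.mem_ker]
    constructor
    · intro h
      have := rTensor_lid_one_tmul_mul l (Algebra.TensorProduct.lmul' A (S := B) z) d
      rw [h, hl] at this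
      simpa using this.symm
    · intro h
      simp [h]

end Frobenius

section DetCoeff
open MvPolynomial

variable {σ R : Type*} [CommRing R]

theorem coeff_X_pow_mul_eq_zero {m : σ →₀ ℕ} {i : σ} {k : ℕ} (h : m i < k)
    (p : MvPolynomial σ R) : coeff m (X i ^ k * p) = 0 := by
  classical
  rw [X_pow_eq_monomial, coeff_monomial_mul', if_neg]
  intro hle
  have := hle i
  simp at this
  omega

variable [Fintype σ] [DecidableEq σ]

open Matrix in
theorem coeff_det_eq_zero {M : Matrix σ σ (MvPolynomial σ R)} (N : σ →₀ ℕ)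
    (u : σ → MvPolynomial σ R) (k : σ) (hk : ((fun i => X i) ᵥ* M) k = 0)
    (h : ∀ j ≠ k, ((fun i => X i) ᵥ* M) j = X j ^ (N j + 1) * u j) :
    coeff N M.det = 0 := by
  have h1 : ((fun i => X i) ᵥ* M) ᵥ* M.adjugate = M.det • (fun i => (X i : MvPolynomial σ R)) := by
    rw [vecMul_vecMul, mul_adjugate, vecMul_smul, vecMul_one]
  have h2 := congrFun h1 k
  rw [Pi.smul_apply, smul_eq_mul] at h2
  rw [← coeff_mul_X N k M.det, ← h2, vecMul, dotProduct, coeff_sum]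
  refine Finset.sum_eq_zero fun j _ => ?_
  by_cases hj : j = k
  · subst hj; simp [hk]
  · rw [h j hj, mul_assoc]
    apply coeff_X_pow_mul_eq_zero
    simp [Ne.symm hj]

open Matrix in
theorem coeff_det_eq {M : Matrix σ σ (MvPolynomial σ R)} (N : σ →₀ ℕ) (u : σ → MvPolynomial σ R)
    (h : ∀ j, ((fun i => X i) ᵥ* M) j = X j ^ (N j + 1) * u j) :
    coeff N M.det = ∏ j, constantCoeff (u j) := by
  let D : Matrix σ σ (MvPolynomial σ R) := diagonal fun j => X j ^ N j * u j
  have hD : ∀ j, ((fun i => X i) ᵥ* D) j = X j ^ (N j + 1) * u j := by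
    intro j
    rw [vecMul_diagonal]
    ring
  have key : ∀ s : Finset σ,
      coeff N (Matrix.of fun i j => if j ∈ s then D i j else M i j).det = coeff N M.det := by
    intro s
    induction s using Finset.induction_on with
    | empty => simp; rfl
    | insert k s hks ih =>
      rw [← ih, ← sub_eq_zero, ← coeff_sub]
      set Q : Matrix σ σ (MvPolynomial σ R) := Matrix.of fun i j => if j ∈ s then D i j else M i j
        with hQ
      have e1 : (Matrix.of fun i j => if j ∈ insert k s then D i j else M i j) =
          Q.updateCol k (fun i => D i k) := by
        ext1 i j
        by_cases hj : j = k
        · subst hj; simp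
        · simp [hj, hQ]
      have e2 : Q = Q.updateCol k (fun i => M i k) := by
        ext1 i j
        by_cases hj : j = k
        · subst hj; simp [hQ, hks]
        · simp [hj]
      have e3 : (Q.updateCol k (fun i => D i k)).det - Q.det =
          (Q.updateCol k (fun i => D i k - M i k)).det := by
        have := det_updateCol_add Q k (fun i => D i k - M i k) (fun i => M i k)
        rw [← e2] at this
        rw [sub_eq_iff_eq_add, ← this]
        congr 2
        ext1 i
        exact (sub_add_cancel _ _).symm
      rw [e1, e3]
      apply coeff_det_eq_zero N u k
      · have := (hD k).trans (h k).symm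
        simp only [vecMul, dotProduct, updateCol_self, mul_sub, Finset.sum_sub_distrib] at this ⊢
        rw [this, sub_self]
      · intro j hj
        by_cases hjs : j ∈ s
        · rw [← hD j]
          simp [vecMul, dotProduct, hj, hQ, hjs]
        · rw [← h j]
          simp [vecMul, dotProduct, hj, hQ, hjs]
  have hu := key Finset.univ
  rw [← hu]
  have e : (Matrix.of fun i j => if j ∈ Finset.univ then D i j else M i j) = D := by
    ext1 i j; simp
  have em : ∏ j, (X j : MvPolynomial σ R) ^ N j = monomial N 1 := by
    rw [monomial_eq, C_1, one_mul, Finsupp.prod_fintype _ _ (by simp)]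
  rw [e, det_diagonal, Finset.prod_mul_distrib, em, coeff_monomial_mul', if_pos le_rfl]
  rw [tsub_self, one_mul, ← constantCoeff_eq, map_prod]

open Matrix in
theorem det_notMem_span {K : Type*} [Field K] (F : σ → MvPolynomial σ K)
    (a : Matrix σ σ (MvPolynomial σ K)) (hF : (fun i => X i) ᵥ* a = F)
    (hint : ∀ i, ∃ p : Polynomial K, p ≠ 0 ∧
      Polynomial.aeval (X i : MvPolynomial σ K) p ∈ Ideal.span (Set.range F)) :
    a.det ∉ Ideal.span (Set.range F) := by
  have h1 : ∀ i, ∃ (k : ℕ) (u : MvPolynomial σ K), constantCoeff u ≠ 0 ∧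
      X i ^ (k + 1) * u ∈ Ideal.span (Set.range F) := by
    intro i
    obtain ⟨p, hp, hpF⟩ := hint i
    obtain ⟨q, hq, hdvd⟩ := Polynomial.exists_eq_pow_rootMultiplicity_mul_and_not_dvd p hp 0
    rw [map_zero, sub_zero] at hq hdvd
    refine ⟨p.rootMultiplicity 0, Polynomial.aeval (X i) q, ?_, ?_⟩
    · rw [Polynomial.X_dvd_iff] at hdvd
      simpa [Polynomial.aeval_def, Polynomial.hom_eval₂, Polynomial.eval₂_at_zero] using hdvd
    · rw [hq, map_mul, map_pow, Polynomial.aeval_X] at hpF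
      rw [pow_succ', mul_assoc]
      exact Ideal.mul_mem_left _ _ hpF
  choose N u hu hmem using h1
  have h2 : ∀ i, ∃ c : σ → MvPolynomial σ K, ∑ j, c j * F j = X i ^ (N i + 1) * u i := fun i =>
    (Ideal.mem_span_range_iff_exists_fun).1 (hmem i)
  choose c hc using h2
  set c' : Matrix σ σ (MvPolynomial σ K) := (Matrix.of c)ᵀ with hc'
  have h3 : ∀ k, (F ᵥ* c') k = X k ^ (N k + 1) * u k := by
    intro k
    rw [← hc k]
    simp [vecMul, dotProduct, hc', mul_comm]
  intro hdet
  have h4 := coeff_det_eq (M := a * c') (Finsupp.equivFunOnFinite.symm N) u (by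
    intro j
    rw [← vecMul_vecMul, hF]
    exact h3 j)
  have h5 : coeff (Finsupp.equivFunOnFinite.symm N) (a * c').det = 0 := by
    obtain ⟨g, hg⟩ := (Ideal.mem_span_range_iff_exists_fun).1 hdet
    have h6 : F ᵥ* c' ᵥ* c'.adjugate = c'.det • F := by
      rw [vecMul_vecMul, mul_adjugate, vecMul_smul, vecMul_one]
    have h7 : ∀ j, F j * c'.det = ∑ k, X k ^ (N k + 1) * (u k * c'.adjugate k j) := by
      intro j
      have := congrFun h6 j
      rw [Pi.smul_apply, smul_eq_mul] at this
      rw [mul_comm, ← this, vecMul, dotProduct]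
      simp only [h3, mul_assoc]
    rw [det_mul, ← hg, Finset.sum_mul, coeff_sum]
    refine Finset.sum_eq_zero fun j _ => ?_
    rw [mul_assoc, h7, Finset.mul_sum, coeff_sum]
    refine Finset.sum_eq_zero fun k _ => ?_
    rw [mul_left_comm]
    apply coeff_X_pow_mul_eq_zero
    simp
  rw [h5] at h4
  exact Finset.prod_ne_zero_iff.2 (fun j _ => hu j) h4.symm

end DetCoeff

section CompleteIntersection
open MvPolynomial

theorem exists_contraction_ne_zero_of_lift_ne_zero {A B S : Type*} [CommRing A] [CommRing B]
    [Algebra A B]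
    [Module.Finite A B] [Module.Projective A B] [CommRing S] [Algebra A S]
    (φ ψ : B →ₐ[A] S) (d : B ⊗[A] B)
    (hd : Algebra.TensorProduct.lift φ ψ (fun _ _ => .all _ _) d ≠ 0) :
    ∃ l : B →ₗ[A] A, ψ (TensorProduct.lid A B (l.rTensor B d)) ≠ 0 := by
  by_contra! h
  apply hd
  obtain ⟨n, p, s, -, -, hps⟩ := Module.Finite.exists_comp_eq_id_of_projective A B
  have key : ∀ z : B ⊗[A] B, Algebra.TensorProduct.lift φ ψ (fun _ _ => .all _ _) z =
      ∑ i, φ (p (Pi.single i 1)) *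
        ψ (TensorProduct.lid A B ((LinearMap.proj i ∘ₗ s : B →ₗ[A] A).rTensor B z)) := by
    intro z
    induction z with
    | zero => simp
    | add x y hx hy => simp only [map_add, hx, hy, mul_add, Finset.sum_add_distrib]
    | tmul x y =>
      have hx : x = ∑ i, s x i • p (Pi.single i 1) := by
        conv_lhs => rw [← LinearMap.id_apply (R := A) x, ← hps, LinearMap.comp_apply,
          pi_eq_sum_univ' (s x), map_sum]
        simp
      simp only [Algebra.TensorProduct.lift_tmul, LinearMap.rTensor_tmul, TensorProduct.lid_tmul,
        LinearMap.comp_apply, LinearMap.proj_apply, map_smul, mul_smul_comm]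
      conv_lhs => rw [hx, map_sum, Finset.sum_mul]
      simp only [map_smul, smul_mul_assoc]
  rw [key]
  exact Finset.sum_eq_zero fun i _ => by rw [h, mul_zero]

variable {A : Type*} [CommRing A] {σ : Type*} [Fintype σ] [DecidableEq σ]
  (f : σ → MvPolynomial σ A)
    (a : Matrix σ σ (MvPolynomial σ A ⊗[A] MvPolynomial σ A))
    {B : Type*} [CommRing B] [Algebra A B] {π : MvPolynomial σ A →ₐ[A] B}


open Matrix in
theorem tmul_one_mul_map_det
    (hπ : Function.Surjective π) (hker : RingHom.ker π = Ideal.span (Set.range f))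
    (ha : ∀ j, (f j) ⊗ₜ[A] 1 - 1 ⊗ₜ[A] (f j) =
      ∑ i, a i j * ((X i) ⊗ₜ[A] 1 - 1 ⊗ₜ[A] (X i))) (b : B) :
    (b ⊗ₜ[A] (1 : B)) * Algebra.TensorProduct.map π π a.det =
      ((1 : B) ⊗ₜ[A] b) * Algebra.TensorProduct.map π π a.det := by
  set Φ := Algebra.TensorProduct.map π π with hΦ
  have hf : ∀ j, π (f j) = 0 := fun j =>
    (RingHom.mem_ker (f := π)).1 (hker ▸ Ideal.subset_span ⟨j, rfl⟩)
  have hX : ∀ i, Φ (X i ⊗ₜ 1 - 1 ⊗ₜ X i) * Φ a.det = 0 := by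
    let y : σ → MvPolynomial σ A ⊗[A] MvPolynomial σ A := fun i => X i ⊗ₜ 1 - 1 ⊗ₜ X i
    have h1 : y ᵥ* a ᵥ* a.adjugate = a.det • y := by
      rw [vecMul_vecMul, mul_adjugate, vecMul_smul, vecMul_one]
    intro i
    have h2 := congrArg Φ (congrFun h1 i)
    rw [Pi.smul_apply, smul_eq_mul, map_mul] at h2
    rw [mul_comm, ← h2, vecMul, dotProduct, map_sum]
    refine Finset.sum_eq_zero fun j _ => ?_
    have h3 : (y ᵥ* a) j = f j ⊗ₜ[A] 1 - 1 ⊗ₜ[A] f j := by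
      rw [ha j]
      simp [vecMul, dotProduct, y, mul_comm]
    rw [map_mul, h3, map_sub, hΦ, Algebra.TensorProduct.map_tmul, Algebra.TensorProduct.map_tmul,
      hf, zero_tmul, tmul_zero, sub_zero, zero_mul]
  obtain ⟨p, rfl⟩ := hπ b
  induction p using MvPolynomial.induction_on with
  | C r =>
    have : π (C r) = algebraMap A B r := π.commutes r
    rw [this, Algebra.algebraMap_eq_smul_one, smul_tmul]
  | add p q hp hq => rw [map_add, add_tmul, tmul_add, add_mul, add_mul, hp, hq]
  | mul_X p i hp =>
    have h := hX i
    rw [map_sub, hΦ, Algebra.TensorProduct.map_tmul, Algebra.TensorProduct.map_tmul, map_one,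
      sub_mul, sub_eq_zero] at h
    have e1 : (π (p * X i)) ⊗ₜ[A] (1 : B) =
        (π p ⊗ₜ[A] (1 : B)) * (π (X i) ⊗ₜ[A] (1 : B)) := by simp
    have e2 : (1 : B) ⊗ₜ[A] (π (p * X i)) =
        ((1 : B) ⊗ₜ[A] π (X i)) * ((1 : B) ⊗ₜ[A] π p) := by simp [mul_comm]
    rw [e1, e2, mul_assoc, h, mul_left_comm, hp, mul_assoc]

/-- Translation by the point `β` after base change to `K`. -/
noncomputable def baseChangeTranslate {K : Type*} [CommRing K] [Algebra A K]
    (β : MvPolynomial σ A →ₐ[A] K) :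
    MvPolynomial σ A →ₐ[A] MvPolynomial σ K :=
  aeval fun i => X i + C (β (X i))

open Matrix in
theorem exists_contraction_ne_zero
    (hπ : Function.Surjective π) (hker : RingHom.ker π = Ideal.span (Set.range f))
    (ha : ∀ j, (f j) ⊗ₜ[A] 1 - 1 ⊗ₜ[A] (f j) =
      ∑ i, a i j * ((X i) ⊗ₜ[A] 1 - 1 ⊗ₜ[A] (X i)))
    [Module.Finite A B] [Module.Projective A B] {K : Type*} [Field K] [Algebra A K]
    (ρ : B →ₐ[A] K) :
    ∃ l : B →ₗ[A] A,
      ρ (TensorProduct.lid A B (l.rTensor B (Algebra.TensorProduct.map π π a.det))) ≠ 0 := by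
  let β : MvPolynomial σ A →ₐ[A] K := ρ.comp π
  have hf : ∀ j, π (f j) = 0 := fun j =>
    (RingHom.mem_ker (f := π)).1 (hker ▸ Ideal.subset_span ⟨j, rfl⟩)
  let τ : MvPolynomial σ A →ₐ[A] MvPolynomial σ K := baseChangeTranslate β
  let ι : K →ₐ[A] MvPolynomial σ K := IsScalarTower.toAlgHom A _ _
  let S : MvPolynomial σ A ⊗[A] MvPolynomial σ A →ₐ[A] MvPolynomial σ K :=
    Algebra.TensorProduct.lift τ (ι.comp β) (fun _ _ => .all _ _)
  let F : σ → MvPolynomial σ K := fun j => τ (f j)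
  let q : MvPolynomial σ K →ₐ[A] (MvPolynomial σ K ⧸ Ideal.span (Set.range F)) :=
    Ideal.Quotient.mkₐ A (Ideal.span (Set.range F))
  have hτ : ∀ p ∈ Ideal.span (Set.range f), τ p ∈ Ideal.span (Set.range F) := by
    intro p hp
    have := Ideal.mem_map_of_mem τ hp
    rwa [Ideal.map_span, ← Set.range_comp] at this
  have hSX : ∀ i, S (X i ⊗ₜ 1 - 1 ⊗ₜ X i) = X i := by
    intro i
    simp [S, τ, baseChangeTranslate, ι, MvPolynomial.algebraMap_eq]
  have hFa : (fun i => X i) ᵥ* S.mapMatrix a = F := by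
    funext j
    have h := congrArg S (ha j)
    have h2 : S (f j ⊗ₜ[A] 1 - 1 ⊗ₜ[A] f j) = F j := by
      simp [S, F, β, hf]
    rw [h2, map_sum] at h
    simp only [map_mul, hSX] at h
    rw [h]
    simp [vecMul, dotProduct, mul_comm]
  have hint : ∀ i, ∃ p : Polynomial K, p ≠ 0 ∧
      Polynomial.aeval (X i : MvPolynomial σ K) p ∈ Ideal.span (Set.range F) := by
    intro i
    obtain ⟨p, hp, hpX⟩ := Algebra.IsIntegral.isIntegral (R := A) (π (X i))
    refine ⟨(p.map (algebraMap A K)).comp (Polynomial.X + Polynomial.C (β (X i))), ?_, ?_⟩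
    · exact ((hp.map _).comp (Polynomial.monic_X_add_C _) (by simp)).ne_zero
    · have h1 : Polynomial.aeval (X i) p ∈ Ideal.span (Set.range f) := by
        rw [← hker, RingHom.mem_ker, ← Polynomial.aeval_algHom_apply]
        exact hpX
      have h2 := hτ _ h1
      rw [← Polynomial.aeval_algHom_apply] at h2
      convert h2 using 1
      simp [Polynomial.aeval_comp, τ, baseChangeTranslate, MvPolynomial.algebraMap_eq]
  have hdet := det_notMem_span F (S.mapMatrix a) hFa hint
  let φ : B →ₐ[A] (MvPolynomial σ K ⧸ Ideal.span (Set.range F)) := AlgHom.liftOfSurjective π hπ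
    (q.comp τ) (fun p hp => Ideal.Quotient.eq_zero_iff_mem.2 (hτ p (hker ▸ hp)))
  let ψ : B →ₐ[A] (MvPolynomial σ K ⧸ Ideal.span (Set.range F)) := (q.comp ι).comp ρ
  have hcomp : (Algebra.TensorProduct.lift φ ψ (fun _ _ => .all _ _)).comp
      (Algebra.TensorProduct.map π π) = q.comp S := by
    apply Algebra.TensorProduct.ext
    · ext i
      simp only [φ, S, AlgHom.comp_apply, Algebra.TensorProduct.includeLeft_apply,
        Algebra.TensorProduct.map_tmul, map_one, Algebra.TensorProduct.lift_tmul, mul_one]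
      exact AlgHom.liftOfSurjective_apply _ _ _ _ _
    · ext i; simp [ψ, S, β]
  obtain ⟨l, hl⟩ := exists_contraction_ne_zero_of_lift_ne_zero φ ψ
    (Algebra.TensorProduct.map π π a.det) (by
    have h := DFunLike.congr_fun hcomp a.det
    rw [AlgHom.comp_apply, AlgHom.comp_apply] at h
    rw [h, AlgHom.map_det]
    exact fun h0 => hdet (Ideal.Quotient.eq_zero_iff_mem.1 h0))
  refine ⟨l, fun hmem => hl ?_⟩
  change q (ι (ρ _)) = 0
  rw [hmem, map_zero, map_zero]

theorem exists_contraction_eq_one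
    (hπ : Function.Surjective π) (hker : RingHom.ker π = Ideal.span (Set.range f))
    (ha : ∀ j, (f j) ⊗ₜ[A] 1 - 1 ⊗ₜ[A] (f j) =
      ∑ i, a i j * ((X i) ⊗ₜ[A] 1 - 1 ⊗ₜ[A] (X i)))
    [Module.Finite A B] [Module.Projective A B] :
    ∃ l : B →ₗ[A] A,
      TensorProduct.lid A B (l.rTensor B (Algebra.TensorProduct.map π π a.det)) = 1 := by
  set d := Algebra.TensorProduct.map π π a.det with hd
  let T : Ideal B :=
    { carrier := {t | ∃ l : B →ₗ[A] A, TensorProduct.lid A B (l.rTensor B d) = t}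
      add_mem' := by
        rintro _ _ ⟨l, rfl⟩ ⟨l', rfl⟩
        exact ⟨l + l', by simp [LinearMap.rTensor_add]⟩
      zero_mem' := ⟨0, by simp⟩
      smul_mem' := by
        rintro b _ ⟨l, rfl⟩
        refine ⟨l ∘ₗ LinearMap.mul A B b, ?_⟩
        have h : ∀ z : B ⊗[A] B, (l ∘ₗ LinearMap.mul A B b).rTensor B z =
            l.rTensor B ((b ⊗ₜ 1) * z) := by
          intro z
          induction z with
          | zero => simp
          | add x y hx hy => simp only [mul_add, map_add, hx, hy]
          | tmul x y => simp
        rw [h, tmul_one_mul_map_det f a hπ hker ha, rTensor_lid_one_tmul_mul, smul_eq_mul] }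
  by_contra hne
  have hT : T ≠ ⊤ := fun h => hne ((Ideal.eq_top_iff_one T).1 h)
  obtain ⟨m, hm, hTm⟩ := Ideal.exists_le_maximal T hT
  let _ : Field (B ⧸ m) := Ideal.Quotient.field m
  obtain ⟨l, hl⟩ := exists_contraction_ne_zero f a hπ hker ha (Ideal.Quotient.mkₐ A m)
  exact hl (Ideal.Quotient.eq_zero_iff_mem.2 (hTm ⟨l, rfl⟩))

end CompleteIntersection

/-- **Scheja–Storch, Proposition 3.1(c)**: `(Δ) = Ann_{B⊗_A B}(I)` and
`Ann_{B⊗_A B}(Δ) = I`, where `B = A[x₁,…,xₙ]/(f₁,…,fₙ)` is a finite flat `A`-algebra,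
`Δ = (π⊗π)(det aᵢⱼ)` for a matrix with `fⱼ⊗1 - 1⊗fⱼ = ∑ᵢ aᵢⱼ (xᵢ⊗1 - 1⊗xᵢ)`, and
`I = ker(m : B ⊗_A B → B)` is the kernel of the multiplication map. -/
theorem span_delta_eq_annihilator {A : Type*} [CommRing A] [IsNoetherianRing A] {n : ℕ}
    (f : Fin n → MvPolynomial (Fin n) A)
    [Module.Finite A (MvPolynomial (Fin n) A ⧸ Ideal.span (Set.range f))]
    [Module.Flat A (MvPolynomial (Fin n) A ⧸ Ideal.span (Set.range f))]
    (a : Matrix (Fin n) (Fin n)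
      (TensorProduct A (MvPolynomial (Fin n) A) (MvPolynomial (Fin n) A)))
    (ha : ∀ j, (f j) ⊗ₜ[A] 1 - 1 ⊗ₜ[A] (f j) =
      ∑ i, a i j * ((MvPolynomial.X i) ⊗ₜ[A] 1 - 1 ⊗ₜ[A] (MvPolynomial.X i))) :
    Ideal.span {Algebra.TensorProduct.map
        (Ideal.Quotient.mkₐ A (Ideal.span (Set.range f)))
        (Ideal.Quotient.mkₐ A (Ideal.span (Set.range f))) a.det} =
      Submodule.annihilator
        (RingHom.ker (Algebra.TensorProduct.lmul' A
          (S := MvPolynomial (Fin n) A ⧸ Ideal.span (Set.range f)))) ∧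
    Ideal.torsionOf _ _
        (Algebra.TensorProduct.map
          (Ideal.Quotient.mkₐ A (Ideal.span (Set.range f)))
          (Ideal.Quotient.mkₐ A (Ideal.span (Set.range f))) a.det) =
      RingHom.ker (Algebra.TensorProduct.lmul' A
        (S := MvPolynomial (Fin n) A ⧸ Ideal.span (Set.range f))) := by
  have : Module.FinitePresentation A (MvPolynomial (Fin n) A ⧸ Ideal.span (Set.range f)) :=
    Module.finitePresentation_of_finite A _
  have : Module.Projective A (MvPolynomial (Fin n) A ⧸ Ideal.span (Set.range f)) :=
    Module.Flat.projective_of_finitePresentation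
  have hπ := Ideal.Quotient.mkₐ_surjective A (Ideal.span (Set.range f))
  have hker := Ideal.Quotient.mkₐ_ker A (Ideal.span (Set.range f))
  obtain ⟨l, hl⟩ := exists_contraction_eq_one f a hπ hker ha
  exact span_eq_annihilator_and_torsionOf_eq_ker (tmul_one_mul_map_det f a hπ hker ha) hl
end
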